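/- Let G be an embedded proper level-planar graph and let λ ≥ 1. Then G admits a λ-drawing if and only if the constraint digraph D_G^λ contains no directed cycle of negative total arc length. -/

import Mathlib

/-- The point in the plane at which vertex `v` with x-coordinate `Γ v` is drawn:
levels serve as y-coordinates. -/
def levelPt {V : Type*} (Γ : V → ℝ) (lv : V → ℕ) (v : V) : ℝ × ℝ :=
  (Γ v, (lv v : ℝ))

/-- The closed straight-line segment representing the edge `(u, v)`. -/
def edgeSeg {V : Type*} (Γ : V → ℝ) (lv : V → ℕ) (u v : V) : Set (ℝ × ℝ) :=
  segment ℝ (levelPt Γ lv u) (levelPt Γ lv v)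

/-- A straight-line level drawing `Γ` of the level graph with edge relation `E` and level
assignment `lv` is level-planar if any point lying on the segments of two distinct edges
is a common endpoint of the two segments. -/
def LevelPlanar {V : Type*} (E : V → V → Prop) (Γ : V → ℝ) (lv : V → ℕ) : Prop :=
  ∀ u v w x, E u v → E w x → (u, v) ≠ (w, x) →
    ∀ p, p ∈ edgeSeg Γ lv u v → p ∈ edgeSeg Γ lv w x →
      (p = levelPt Γ lv u ∨ p = levelPt Γ lv v) ∧ (p = levelPt Γ lv w ∨ p = levelPt Γ lv x)

/-- The slope of the edge `(u, v)` in the drawing `Γ`. -/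
noncomputable def slopeOf {V : Type*} (Γ : V → ℝ) (lv : V → ℕ) (u v : V) : ℝ :=
  (Γ v - Γ u) / ((lv v : ℝ) - (lv u : ℝ))

/-- The integer `xbar` is a gap in the integer-coordinate drawing `Γ`. -/
def IsGap {V : Type*} (E : V → V → Prop) (Γ : V → ℤ) (xbar : ℤ) : Prop :=
  (∀ v, Γ v ≠ xbar) ∧ (∃ v₁, Γ v₁ < xbar) ∧ (∃ v₂, xbar < Γ v₂) ∧
    ∀ u v, E u v → ¬ (min (Γ u) (Γ v) < xbar ∧ xbar < max (Γ u) (Γ v))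

/-- A drawing is compact if it has no gap. -/
def CompactDrawing {V : Type*} (E : V → V → Prop) (Γ : V → ℤ) : Prop :=
  ¬ ∃ xbar : ℤ, IsGap E Γ xbar

/-- `emb` is an embedding of the proper level graph `(E, lv)`: a family of total orders, one
on each level, such that no two edges interleave. -/
structure IsLevelEmbedding {V : Type*} (E : V → V → Prop) (lv : V → ℕ)
    (emb : V → V → Prop) : Prop where
  same_level : ∀ u v, emb u v → lv u = lv v
  irrefl : ∀ u, ¬ emb u u
  trans : ∀ u v w, emb u v → emb v w → emb u w
  total : ∀ u v, lv u = lv v → u ≠ v → emb u v ∨ emb v u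
  no_interleave : ∀ u v w x, E u w → E v x → emb u v → ¬ emb x w

/-- `u` and `v` are consecutive vertices on a common level: `u ≺ v` and no vertex lies
strictly between them. -/
def ConsecVert {V : Type*} (emb : V → V → Prop) (u v : V) : Prop :=
  emb u v ∧ ¬ ∃ z, emb u z ∧ emb z v

/-- `Γ` is a λ-drawing of the embedded proper level-planar graph `(E, lv, emb)`:
an embedding-preserving level-planar straight-line level drawing with integer x-coordinates
in which every edge has slope in `{0, 1, …, λ - 1}`. -/
def IsLamDrawing {V : Type*} (E : V → V → Prop) (lv : V → ℕ) (emb : V → V → Prop)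
    (lam : ℕ) (Γ : V → ℤ) : Prop :=
  (∀ u v, lv u = lv v → (emb u v ↔ Γ u < Γ v)) ∧
  (∀ u v, E u v → 0 ≤ Γ v - Γ u ∧ Γ v - Γ u ≤ (lam : ℤ) - 1) ∧
  LevelPlanar E (fun v => (Γ v : ℝ)) lv

/-- `x` is a distance labeling of the constraint digraph `D_G^λ`: for every arc `(a, b)` of
length `ℓ` we have `x b ≤ x a + ℓ`.  The arcs are: `(u, v)` of length `λ - 1` and `(v, u)` of
length `0` for every edge `(u, v)`, and `(v, u)` of length `-1` for consecutive `u ≺ v`. -/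
def IsDistanceLabeling {V : Type*} (E : V → V → Prop) (emb : V → V → Prop)
    (lam : ℕ) (x : V → ℤ) : Prop :=
  (∀ u v, E u v → x v ≤ x u + ((lam : ℤ) - 1) ∧ x u ≤ x v + 0) ∧
  (∀ u v, ConsecVert emb u v → x u ≤ x v + (-1))

/-- Directed walks in the constraint digraph `D_G^λ`, recording the start vertex, the end
vertex, the number of arcs, and the total arc length. -/
inductive DWalk {V : Type*} (E : V → V → Prop) (emb : V → V → Prop) (lam : ℕ) :
    V → V → ℕ → ℤ → Prop
  | refl (v : V) : DWalk E emb lam v v 0 0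
  | edgeFwd {u v w : V} {n : ℕ} {L : ℤ} :
      DWalk E emb lam u v n L → E v w → DWalk E emb lam u w (n + 1) (L + ((lam : ℤ) - 1))
  | edgeBack {u v w : V} {n : ℕ} {L : ℤ} :
      DWalk E emb lam u v n L → E w v → DWalk E emb lam u w (n + 1) (L + 0)
  | consecArc {u v w : V} {n : ℕ} {L : ℤ} :
      DWalk E emb lam u v n L → ConsecVert emb w v → DWalk E emb lam u w (n + 1) (L + (-1))

/-- The constraint digraph `D_G^λ` contains no directed cycle of negative total length. -/
def NoNegCycle {V : Type*} (E : V → V → Prop) (emb : V → V → Prop) (lam : ℕ) : Prop :=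
  ¬ ∃ (v : V) (n : ℕ) (L : ℤ), 0 < n ∧ DWalk E emb lam v v n L ∧ L < 0

/-- The arcs of the constraint digraph `D_G^λ`, with their lengths. -/
inductive DArc {V : Type*} (E : V → V → Prop) (emb : V → V → Prop) (lam : ℕ) :
    V → V → ℤ → Prop
  | edgeFwd {v w : V} : E v w → DArc E emb lam v w ((lam : ℤ) - 1)
  | edgeBack {v w : V} : E w v → DArc E emb lam v w 0
  | consecArc {v w : V} : ConsecVert emb w v → DArc E emb lam v w (-1)

/-- Simple directed paths in the constraint digraph `D_G^λ`, recording the start vertex, the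
end vertex, the set of visited vertices, and the total arc length. -/
inductive DPath {V : Type*} (E : V → V → Prop) (emb : V → V → Prop) (lam : ℕ) :
    V → V → Finset V → ℤ → Prop
  | refl (v : V) : DPath E emb lam v v {v} 0
  | snoc {u v w : V} {S : Finset V} {L c : ℤ} (hw : w ∉ S) :
      DPath E emb lam u v S L → DArc E emb lam v w c → DPath E emb lam u w (S.cons w hw) (L + c)

section ConstraintDigraph

variable {V : Type*} {E : V → V → Prop} {emb : V → V → Prop} {lam : ℕ}

theorem DArc.neg_one_le (hlam : 1 ≤ lam) {v w : V} {c : ℤ} (h : DArc E emb lam v w c) :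
    -1 ≤ c := by
  cases h <;> omega

theorem DWalk.snoc {u v w : V} {n : ℕ} {L c : ℤ} (h : DWalk E emb lam u v n L)
    (ha : DArc E emb lam v w c) : DWalk E emb lam u w (n + 1) (L + c) := by
  cases ha with
  | edgeFwd h' => exact h.edgeFwd h'
  | edgeBack h' => exact h.edgeBack h'
  | consecArc h' => exact h.consecArc h'

theorem DWalk.le_add_of_isDistanceLabeling {x : V → ℤ}
    (hx : IsDistanceLabeling E emb lam x) {u v : V} {n : ℕ} {L : ℤ}
    (h : DWalk E emb lam u v n L) : x v ≤ x u + L := by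
  induction h with
  | refl => simp
  | edgeFwd _ h' ih => have := (hx.1 _ _ h').1; omega
  | edgeBack _ h' ih => have := (hx.1 _ _ h').2; omega
  | consecArc _ h' ih => have := hx.2 _ _ h'; omega

theorem DPath.neg_card_le (hlam : 1 ≤ lam) {u v : V} {S : Finset V} {L : ℤ}
    (h : DPath E emb lam u v S L) : -(S.card : ℤ) ≤ L := by
  induction h with
  | refl => simp
  | snoc hw _ ha ih =>
    have := ha.neg_one_le hlam
    rw [Finset.card_cons]
    push_cast
    omega

/-- A simple path can be split at any visited vertex. -/
theorem DPath.split {u v : V} {S : Finset V} {L : ℤ} (h : DPath E emb lam u v S L)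
    {w : V} (hw : w ∈ S) :
    ∃ S' L' n, DPath E emb lam u w S' L' ∧ DWalk E emb lam w v n (L - L') := by
  induction h with
  | refl =>
    obtain rfl := Finset.mem_singleton.1 hw
    exact ⟨_, _, 0, .refl w, by simpa using DWalk.refl w⟩
  | @snoc v y S L c hy hp ha ih =>
    rcases Finset.mem_cons.1 hw with rfl | hw
    · exact ⟨_, _, 0, hp.snoc hy ha, by simpa using DWalk.refl w⟩
    · obtain ⟨S', L', n, hp', hwalk⟩ := ih hw
      refine ⟨S', L', n + 1, hp', ?_⟩
      have := hwalk.snoc ha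
      rwa [show L - L' + c = L + c - L' by ring] at this

theorem DPath.exists_snoc_le (hneg : NoNegCycle E emb lam) {u v w : V} {S : Finset V} {L c : ℤ}
    (h : DPath E emb lam u v S L) (ha : DArc E emb lam v w c) :
    ∃ S' L', L' ≤ L + c ∧ DPath E emb lam u w S' L' := by
  by_cases hw : w ∈ S
  · obtain ⟨S', L', n, hp, hwalk⟩ := h.split hw
    refine ⟨S', L', ?_, hp⟩
    by_contra hlt
    exact hneg ⟨w, n + 1, _, n.succ_pos, hwalk.snoc ha, by omega⟩
  · exact ⟨_, _, le_rfl, h.snoc hw ha⟩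

/-- Without negative cycles every walk can be shortcut to a simple path. -/
theorem DWalk.exists_dPath_le (hneg : NoNegCycle E emb lam) {u v : V} {n : ℕ} {L : ℤ}
    (h : DWalk E emb lam u v n L) : ∃ S L', L' ≤ L ∧ DPath E emb lam u v S L' := by
  have extend : ∀ {v w : V} {L c : ℤ}, DArc E emb lam v w c →
      (∃ S L', L' ≤ L ∧ DPath E emb lam u v S L') →
      ∃ S L', L' ≤ L + c ∧ DPath E emb lam u w S L' := by
    rintro v w L c ha ⟨S, L', hL, hp⟩
    obtain ⟨S', L'', hL', hp'⟩ := hp.exists_snoc_le hneg ha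
    exact ⟨S', L'', by omega, hp'⟩
  induction h with
  | refl => exact ⟨_, _, le_rfl, .refl u⟩
  | edgeFwd _ h' ih => exact extend (.edgeFwd h') ih
  | edgeBack _ h' ih => exact extend (.edgeBack h') ih
  | consecArc _ h' ih => exact extend (.consecArc h') ih

theorem exists_isDistanceLabeling [Fintype V] (hlam : 1 ≤ lam) (hneg : NoNegCycle E emb lam) :
    ∃ x : V → ℤ, IsDistanceLabeling E emb lam x := by
  let W : V → Set ℤ := fun v => {L | ∃ u n, DWalk E emb lam u v n L}
  have hbdd : ∀ v, BddBelow (W v) := by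
    refine fun v => ⟨-(Fintype.card V : ℤ), ?_⟩
    rintro L ⟨u, n, h⟩
    obtain ⟨S, L', hL, hp⟩ := h.exists_dPath_le hneg
    have h1 := hp.neg_card_le hlam
    have h2 := S.card_le_univ
    omega
  have hstep : ∀ {v w : V} {c : ℤ}, DArc E emb lam v w c → sInf (W w) ≤ sInf (W v) + c := by
    intro v w c ha
    obtain ⟨u, n, h⟩ : sInf (W v) ∈ W v := Int.csInf_mem ⟨0, v, 0, .refl v⟩ (hbdd v)
    exact csInf_le (hbdd w) ⟨u, n + 1, h.snoc ha⟩
  exact ⟨fun v => sInf (W v), fun u v h => ⟨hstep (.edgeFwd h), hstep (.edgeBack h)⟩,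
    fun u v h => hstep (.consecArc h)⟩

end ConstraintDigraph

section Drawing

variable {V : Type*} {E : V → V → Prop} {lv : V → ℕ} {emb : V → V → Prop} {lam : ℕ}

theorem IsLamDrawing.isDistanceLabeling (hemb : IsLevelEmbedding E lv emb) {Γ : V → ℤ}
    (h : IsLamDrawing E lv emb lam Γ) : IsDistanceLabeling E emb lam Γ := by
  refine ⟨fun u v huv => ?_, fun u v huv => ?_⟩
  · have := h.2.1 u v huv
    omega
  · have := (h.1 u v (hemb.same_level u v huv.1)).1 huv.1
    omega

theorem IsDistanceLabeling.lt_of_emb [Finite V] (hemb : IsLevelEmbedding E lv emb) {x : V → ℤ}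
    (hx : IsDistanceLabeling E emb lam x) {u v : V} (h : emb u v) : x u < x v := by
  induction hn : {z | emb u z ∧ emb z v}.ncard using Nat.strong_induction_on generalizing u v with
  | _ n ih =>
    subst hn
    by_cases hc : ∃ z, emb u z ∧ emb z v
    · obtain ⟨z, huz, hzv⟩ := hc
      refine (ih _ (Set.ncard_lt_ncard ⟨?_, ?_⟩) huz rfl).trans
        (ih _ (Set.ncard_lt_ncard ⟨?_, ?_⟩) hzv rfl)
      · exact fun y hy => ⟨hy.1, hemb.trans _ _ _ hy.2 hzv⟩
      · exact fun hsub => hemb.irrefl z (hsub ⟨huz, hzv⟩).2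
      · exact fun y hy => ⟨hemb.trans _ _ _ huz hy.1, hy.2⟩
      · exact fun hsub => hemb.irrefl z (hsub ⟨huz, hzv⟩).1
    · have := hx.2 u v ⟨h, hc⟩
      omega

theorem mem_edgeSeg_iff {Γ : V → ℝ} {u v : V} {p : ℝ × ℝ} (huv : lv v = lv u + 1) :
    p ∈ edgeSeg Γ lv u v ↔
      ∃ t ∈ Set.Icc (0 : ℝ) 1, p = (Γ u + t * (Γ v - Γ u), (lv u : ℝ) + t) := by
  simp only [edgeSeg, segment_eq_image', Set.mem_image, levelPt, huv, eq_comm (a := p)]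
  simp

theorem levelPlanar_of_emb_lt (hE : ∀ u v, E u v → lv v = lv u + 1)
    (hemb : IsLevelEmbedding E lv emb) {Γ : V → ℝ} (hΓ : ∀ u v, emb u v → Γ u < Γ v) :
    LevelPlanar E Γ lv := by
  intro u v w x huv hwx hne p hp hq
  have hv := hE u v huv
  have hx := hE w x hwx
  obtain ⟨t, ⟨ht0, ht1⟩, rfl⟩ := (mem_edgeSeg_iff hv).1 hp
  obtain ⟨s, ⟨hs0, hs1⟩, hs⟩ := (mem_edgeSeg_iff hx).1 hq
  obtain ⟨hs₁, hs₂⟩ := Prod.mk.inj hs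
  -- `emb`-ordered tails on a common level: the segments can meet only at their heads.
  have head : ∀ {u v w x : V} {t : ℝ}, E u v → E w x → emb u w → 0 ≤ t → t ≤ 1 →
      Γ u + t * (Γ v - Γ u) = Γ w + t * (Γ x - Γ w) → t = 1 := by
    intro u v w x t huv hwx huw ht0 ht1 heq
    have huw' := hΓ u w huw
    have hvx : Γ v ≤ Γ x := by
      by_cases hvx : v = x
      · rw [hvx]
      · have hlv : lv v = lv x := by rw [hE u v huv, hE w x hwx, hemb.same_level u w huw]
        rcases hemb.total v x hlv hvx with h | h
        · exact (hΓ v x h).le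
        · exact (hemb.no_interleave u w v x huv hwx huw h).elim
    nlinarith [mul_nonneg ht0 (sub_nonneg.2 hvx)]
  have key : (t = 0 ∨ t = 1) ∧ (s = 0 ∨ s = 1) := by
    rcases lt_trichotomy (lv u) (lv w) with h | h | h
    · have : (lv u : ℝ) + 1 ≤ lv w := by exact_mod_cast h
      exact ⟨.inr (by linarith), .inl (by linarith)⟩
    · obtain rfl : t = s := by rw [h] at hs₂; linarith
      suffices t = 0 ∨ t = 1 from ⟨this, this⟩
      by_cases huw : u = w
      · subst huw
        have hvx : v ≠ x := fun hvx => hne (by rw [hvx])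
        have hne' : Γ v ≠ Γ x := by
          rcases hemb.total v x (by omega) hvx with h | h
          · exact (hΓ _ _ h).ne
          · exact (hΓ _ _ h).ne'
        left
        have : t * (Γ v - Γ x) = 0 := by linarith
        exact (mul_eq_zero.1 this).resolve_right (sub_ne_zero.2 hne')
      · right
        rcases hemb.total u w h huw with h | h
        · exact head huv hwx h ht0 ht1 hs₁
        · exact head hwx huv h ht0 ht1 hs₁.symm
    · have : (lv w : ℝ) + 1 ≤ lv u := by exact_mod_cast h
      exact ⟨.inl (by linarith), .inr (by linarith)⟩
  refine ⟨?_, ?_⟩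
  · rcases key.1 with rfl | rfl
    · left; simp [levelPt]
    · right; simp [levelPt, hv]
  · rw [hs]
    rcases key.2 with rfl | rfl
    · left; simp [levelPt]
    · right; simp [levelPt, hx]

theorem IsDistanceLabeling.isLamDrawing [Finite V] (hE : ∀ u v, E u v → lv v = lv u + 1)
    (hemb : IsLevelEmbedding E lv emb) {x : V → ℤ} (hx : IsDistanceLabeling E emb lam x) :
    IsLamDrawing E lv emb lam x := by
  refine ⟨fun u v huv => ⟨hx.lt_of_emb hemb, fun hlt => ?_⟩, fun u v huv => ?_,
    levelPlanar_of_emb_lt hE hemb fun u v huv => Int.cast_lt.2 (hx.lt_of_emb hemb huv)⟩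
  · refine (hemb.total u v huv (by rintro rfl; exact hlt.false)).resolve_right fun h => ?_
    exact hlt.asymm (hx.lt_of_emb hemb h)
  · have := hx.1 u v huv
    omega

end Drawing

/-- An embedded proper level-planar graph admits a λ-drawing if and only
if its constraint digraph `D_G^λ` contains no directed cycle of negative total length. -/
theorem statement9 {V : Type*} [Fintype V] (E : V → V → Prop) (lv : V → ℕ)
    (hE : ∀ u v, E u v → lv v = lv u + 1)
    (emb : V → V → Prop) (hemb : IsLevelEmbedding E lv emb)
    (lam : ℕ) (hlam : 1 ≤ lam) :
    (∃ Γ : V → ℤ, IsLamDrawing E lv emb lam Γ) ↔ NoNegCycle E emb lam := by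
  constructor
  · rintro ⟨Γ, hΓ⟩ ⟨v, n, L, -, hwalk, hL⟩
    have := hwalk.le_add_of_isDistanceLabeling (hΓ.isDistanceLabeling hemb)
    omega
  · intro hneg
    obtain ⟨x, hx⟩ := exists_isDistanceLabeling hlam hneg
    exact ⟨x, hx.isLamDrawing hE hemb⟩
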